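/- arXiv:1108.1179 — 3 statements merged into one kernel-verified Lean document; each statement's English description precedes it below -/
import Mathlib

section
/- Let λ, μ > 0 with ρ = λ/μ < 1, let i, j ≥ 0 be integers, and let t ≥ 0. Then p_{ij}(t) ≥ 0, where p_{ij}(t) = (2/π)·ρ^{(j−i)/2}·∫₀^π e^{−μ t γ(y)}/γ(y) · a_i(y)·a_j(y) dy + (1−ρ)·ρ^j. -/
open Real MeasureTheory Set Filter

/-- γ(y) = 1 + ρ − 2√ρ·cos(y). -/
noncomputable def gam (ρ y : ℝ) : ℝ := 1 + ρ - 2 * Real.sqrt ρ * Real.cos y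

/-- a_k(y) = sin(k·y) − √ρ·sin((k+1)·y). -/
noncomputable def aco (ρ : ℝ) (k : ℕ) (y : ℝ) : ℝ :=
  Real.sin ((k : ℝ) * y) - Real.sqrt ρ * Real.sin (((k : ℝ) + 1) * y)

/-- Transient expected queue length of an M/M/1 queue started with `i` customers. -/
noncomputable def EL (lam mu : ℝ) (i : ℕ) (t : ℝ) : ℝ :=
  (2 / Real.pi) * (lam / mu) ^ ((1 - (i : ℝ)) / 2) *
    (∫ y in (0 : ℝ)..Real.pi,
      Real.exp (-(mu * t * gam (lam / mu) y)) / (gam (lam / mu) y) ^ 2 *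
        (aco (lam / mu) i y * Real.sin y)) +
  (lam / mu) / (1 - lam / mu)

/-- Transient probability that an M/M/1 queue started with `i` customers has `j` at time `t`. -/
noncomputable def pq (lam mu : ℝ) (i j : ℕ) (t : ℝ) : ℝ :=
  (2 / Real.pi) * (lam / mu) ^ (((j : ℝ) - (i : ℝ)) / 2) *
    (∫ y in (0 : ℝ)..Real.pi,
      Real.exp (-(mu * t * gam (lam / mu) y)) / gam (lam / mu) y *
        (aco (lam / mu) i y * aco (lam / mu) j y)) +
  (1 - lam / mu) * (lam / mu) ^ j

/-- Erlang(n) density with rate `mu`: f_n(t) = μⁿ t^{n−1} e^{−μt}/(n−1)!. -/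
noncomputable def erl (mu : ℝ) (n : ℕ) (t : ℝ) : ℝ :=
  mu ^ n * t ^ (n - 1) * Real.exp (-(mu * t)) / (Nat.factorial (n - 1) : ℝ)

/-- Expected total time to complete queue with `a` customers first, then queue with `b`. -/
noncomputable def ETT (lam mu : ℝ) (a b : ℕ) : ℝ :=
  ((a : ℝ) + 2) / mu + (1 / mu) * ∫ t in Set.Ioi (0 : ℝ), erl mu (a + 1) t * EL lam mu b t

namespace PQ

noncomputable def g (r y : ℝ) : ℝ := 1 + r ^ 2 - 2 * r * Real.cos y

noncomputable def A (r : ℝ) (k : ℕ) (y : ℝ) : ℝ :=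
  Real.sin ((k : ℝ) * y) - r * Real.sin (((k : ℝ) + 1) * y)

lemma g_lower {r : ℝ} (h0 : 0 < r) (y : ℝ) : (1 - r) ^ 2 ≤ g r y := by
  unfold g
  nlinarith [Real.cos_le_one y]

lemma g_pos {r : ℝ} (h0 : 0 < r) (h1 : r < 1) (y : ℝ) : 0 < g r y :=
  lt_of_lt_of_le (by have : 0 < 1 - r := by linarith
                     positivity) (g_lower h0 y)

lemma g_cont (r : ℝ) : Continuous (g r) := by unfold g; fun_prop

lemma A_cont (r : ℝ) (k : ℕ) : Continuous (A r k) := by unfold A; fun_prop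

lemma lin3 {f h k : ℝ → ℝ} (hf : Continuous f) (hh : Continuous h) (hk : Continuous k)
    (a b c : ℝ) :
    (∫ y in (0:ℝ)..π, (a * f y + b * h y + c * k y)) =
      a * (∫ y in (0:ℝ)..π, f y) + b * (∫ y in (0:ℝ)..π, h y) + c * (∫ y in (0:ℝ)..π, k y) := by
  rw [intervalIntegral.integral_add, intervalIntegral.integral_add,
    intervalIntegral.integral_const_mul, intervalIntegral.integral_const_mul,
    intervalIntegral.integral_const_mul]
  all_goals exact Continuous.intervalIntegrable (by fun_prop) _ _

lemma sin_step (k : ℕ) (y : ℝ) : Real.sin (((k + 2 : ℕ) : ℝ) * y) =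
    2 * Real.cos y * Real.sin (((k + 1 : ℕ) : ℝ) * y) - Real.sin ((k : ℝ) * y) := by
  have e1 : ((k + 2 : ℕ) : ℝ) * y = ((k + 1 : ℕ) : ℝ) * y + y := by push_cast; ring
  have e2 : (k : ℝ) * y = ((k + 1 : ℕ) : ℝ) * y - y := by push_cast; ring
  rw [e1, e2, Real.sin_add, Real.sin_sub]; ring

lemma A_step (r : ℝ) (k : ℕ) (y : ℝ) :
    2 * Real.cos y * A r (k + 1) y = A r (k + 2) y + A r k y := by
  have h1 := sin_step k y
  have h2 := sin_step (k + 1) y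
  unfold A
  push_cast at *
  have e1 : (k : ℝ) + 1 + 2 = k + 2 + 1 := by ring
  rw [e1] at h2
  have e2 : (k : ℝ) + 1 + 1 = k + 2 := by ring
  rw [e2] at h2 ⊢
  rw [h2, h1]; ring

lemma A_zero (r : ℝ) (y : ℝ) :
    2 * r * Real.cos y * A r 0 y = r * A r 1 y + A r 0 y := by
  unfold A
  have := Real.sin_two_mul y
  norm_num
  rw [this]; ring

lemma int_cos (n : ℕ) : (∫ y in (0:ℝ)..π, Real.cos (((n + 1 : ℕ) : ℝ) * y)) = 0 := by
  have hn : ((n + 1 : ℕ) : ℝ) ≠ 0 := by positivity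
  rw [intervalIntegral.integral_comp_mul_left (fun y => Real.cos y) hn, integral_cos,
    Real.sin_nat_mul_pi]
  simp

lemma int_sin_zero : (∫ y in (0:ℝ)..π, Real.sin y * Real.sin (((0 + 1 : ℕ) : ℝ) * y)) = π / 2 := by
  have := integral_sin_sq (a := 0) (b := π)
  simp at this
  simp [← pow_two, this]

lemma int_sin_succ (k : ℕ) :
    (∫ y in (0:ℝ)..π, Real.sin y * Real.sin (((k + 2 : ℕ) : ℝ) * y)) = 0 := by
  have : (fun y : ℝ => Real.sin y * Real.sin (((k + 2 : ℕ) : ℝ) * y)) =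
      fun y : ℝ => (1/2) * Real.cos (((k + 1 : ℕ) : ℝ) * y) +
        (-1/2) * Real.cos (((k + 2 + 1 : ℕ) : ℝ) * y) + 0 * (0 : ℝ) := by
    ext y
    have e1 : ((k + 1 : ℕ) : ℝ) * y = ((k + 2 : ℕ) : ℝ) * y - y := by push_cast; ring
    have e2 : ((k + 2 + 1 : ℕ) : ℝ) * y = ((k + 2 : ℕ) : ℝ) * y + y := by push_cast; ring
    rw [e1, e2, Real.cos_add, Real.cos_sub]; ring
  rw [this, lin3 (by fun_prop) (by fun_prop) (by fun_prop), int_cos, int_cos]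
  simp

noncomputable def S (r : ℝ) (k : ℕ) : ℝ :=
  ∫ y in (0:ℝ)..π, Real.sin y * Real.sin ((k : ℝ) * y) / g r y

lemma S_cont {r : ℝ} (h0 : 0 < r) (h1 : r < 1) (k : ℕ) :
    Continuous fun y => Real.sin y * Real.sin ((k : ℝ) * y) / g r y :=
  Continuous.div (by fun_prop) (g_cont r) (fun y => (g_pos h0 h1 y).ne')

lemma S_rec {r : ℝ} (h0 : 0 < r) (h1 : r < 1) (k : ℕ) :
    (1 + r ^ 2) * S r (k + 1) + (-r) * S r (k + 2) + (-r) * S r k =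
      ∫ y in (0:ℝ)..π, Real.sin y * Real.sin (((k + 1 : ℕ) : ℝ) * y) := by
  unfold S
  rw [← lin3 (S_cont h0 h1 _) (S_cont h0 h1 _) (S_cont h0 h1 _)]
  congr 1
  ext y
  have := (g_pos h0 h1 y).ne'
  rw [sin_step]
  field_simp
  unfold g
  ring

lemma S_bound {r : ℝ} (h0 : 0 < r) (h1 : r < 1) (k : ℕ) :
    |S r k| ≤ ((1 - r) ^ 2)⁻¹ * π := by
  have hr : 0 < (1 - r) ^ 2 := by
    have : 0 < 1 - r := by linarith
    positivity
  have := intervalIntegral.norm_integral_le_of_norm_le_const (a := 0) (b := π)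
    (f := fun y => Real.sin y * Real.sin ((k : ℝ) * y) / g r y) (C := ((1 - r) ^ 2)⁻¹) ?_
  · simpa [S, abs_of_pos Real.pi_pos] using this
  · intro y _
    rw [norm_div, norm_mul, div_eq_mul_inv]
    have a1 : ‖Real.sin y‖ ≤ 1 := Real.abs_sin_le_one _
    have a2 : ‖Real.sin (k * y)‖ ≤ 1 := Real.abs_sin_le_one _
    have a3 : ‖g r y‖⁻¹ ≤ ((1 - r) ^ 2)⁻¹ := by
      apply inv_anti₀ hr
      rw [Real.norm_of_nonneg (g_pos h0 h1 y).le]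
      exact g_lower h0 y
    calc _ ≤ 1 * ((1 - r) ^ 2)⁻¹ := by
          apply mul_le_mul (mul_le_one₀ a1 (norm_nonneg _) a2) a3 (by positivity) (by norm_num)
      _ = _ := one_mul _

lemma D_zero {r : ℝ} (h0 : 0 < r) (h1 : r < 1) (k : ℕ) : S r (k + 2) = r * S r (k + 1) := by
  have hD : ∀ m, S r (k + 2) - r * S r (k + 1) =
      r ^ m * (S r (k + m + 2) - r * S r (k + m + 1)) := by
    intro m
    induction m with
    | zero => simp
    | succ m ih =>
      rw [ih]
      have h := S_rec h0 h1 (k + m + 1)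
      rw [int_sin_succ] at h
      have e : k + (m + 1) + 2 = k + m + 1 + 2 := by ring
      have e' : k + (m + 1) + 1 = k + m + 1 + 1 := by ring
      rw [e, e', pow_succ, mul_assoc]
      congr 1
      have e3 : k + m + 1 + 1 = k + m + 2 := by ring
      rw [e3] at *
      linear_combination h
  have hlim : Tendsto (fun m : ℕ => r ^ m * (2 * (((1 - r) ^ 2)⁻¹ * π))) atTop (nhds 0) := by
    simpa using (tendsto_pow_atTop_nhds_zero_of_lt_one h0.le h1).mul_const
      (2 * (((1 - r) ^ 2)⁻¹ * π))
  have hle : |S r (k + 2) - r * S r (k + 1)| ≤ 0 := by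
    apply ge_of_tendsto' hlim
    intro m
    rw [hD m, abs_mul, abs_of_nonneg (pow_nonneg h0.le m)]
    apply mul_le_mul_of_nonneg_left _ (pow_nonneg h0.le m)
    have b1 := abs_le.1 (S_bound h0 h1 (k + m + 2))
    have b2 := S_bound h0 h1 (k + m + 1)
    have b3 : |r * S r (k + m + 1)| ≤ ((1 - r) ^ 2)⁻¹ * π := by
      rw [abs_mul, abs_of_pos h0]
      nlinarith [abs_nonneg (S r (k + m + 1))]
    have b4 := abs_le.1 b3
    rw [abs_le]
    constructor <;> linarith
  have := abs_nonpos_iff.1 hle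
  linarith

lemma S_zero (r : ℝ) : S r 0 = 0 := by simp [S]

lemma S_val {r : ℝ} (h0 : 0 < r) (h1 : r < 1) (k : ℕ) : S r (k + 1) = r ^ k * (π / 2) := by
  induction k with
  | zero =>
    have h := S_rec h0 h1 0
    rw [int_sin_zero, S_zero, D_zero h0 h1] at h
    simp only [zero_add] at *
    linear_combination h
  | succ k ih =>
    rw [D_zero h0 h1, ih]; ring

noncomputable def G (r : ℝ) (n i j : ℕ) : ℝ :=
  ∫ y in (0:ℝ)..π, (2 * r * Real.cos y) ^ n / g r y * (A r i y * A r j y)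

lemma G_cont {r : ℝ} (h0 : 0 < r) (h1 : r < 1) (n i j : ℕ) :
    Continuous fun y => (2 * r * Real.cos y) ^ n / g r y * (A r i y * A r j y) :=
  (Continuous.div (by fun_prop) (g_cont r) (fun y => (g_pos h0 h1 y).ne')).mul
    ((A_cont r i).mul (A_cont r j))

lemma G_symm (r : ℝ) (n i j : ℕ) : G r n i j = G r n j i := by
  unfold G
  congr 1; ext y; ring

lemma G_succ {r : ℝ} (h0 : 0 < r) (h1 : r < 1) (n i j : ℕ) :
    G r (n + 1) i (j + 1) = r * G r n i (j + 2) + r * G r n i j := by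
  have h : G r (n + 1) i (j + 1) = r * G r n i (j + 2) + r * G r n i j + 0 * G r n i j := by
    unfold G
    rw [← lin3 (G_cont h0 h1 _ _ _) (G_cont h0 h1 _ _ _) (G_cont h0 h1 _ _ _)]
    congr 1; ext y
    have := A_step r j y
    linear_combination (2 * r * Real.cos y) ^ n / g r y * A r i y * r * this
  linarith

lemma G_succ_zero {r : ℝ} (h0 : 0 < r) (h1 : r < 1) (n i : ℕ) :
    G r (n + 1) i 0 = r * G r n i 1 + G r n i 0 := by
  have h : G r (n + 1) i 0 = r * G r n i 1 + 1 * G r n i 0 + 0 * G r n i 0 := by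
    unfold G
    rw [← lin3 (G_cont h0 h1 _ _ _) (G_cont h0 h1 _ _ _) (G_cont h0 h1 _ _ _)]
    congr 1; ext y
    have := A_zero r y
    linear_combination (2 * r * Real.cos y) ^ n / g r y * A r i y * this
  linarith

lemma G_row {r : ℝ} (h0 : 0 < r) (h1 : r < 1) (j : ℕ) :
    G r 0 0 j = (π / 2) * ((if 0 = j then 1 else 0) - (1 - r ^ 2) * r ^ (0 + j)) := by
  have h : G r 0 0 j = (-r) * S r j + r ^ 2 * S r (j + 1) + 0 * S r j := by
    unfold G S
    rw [← lin3 (S_cont h0 h1 _) (S_cont h0 h1 _) (S_cont h0 h1 _)]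
    congr 1; ext y
    unfold A
    push_cast
    simp only [zero_mul, Real.sin_zero, zero_add, one_mul]
    ring
  rw [h]
  cases j with
  | zero => rw [S_val h0 h1, S_zero]; simp; ring
  | succ j => rw [S_val h0 h1, S_val h0 h1]; simp; ring

lemma G_base {r : ℝ} (h0 : 0 < r) (h1 : r < 1) (i : ℕ) : ∀ j,
    G r 0 i j = (π / 2) * ((if i = j then 1 else 0) - (1 - r ^ 2) * r ^ (i + j)) := by
  have hr : r ≠ 0 := h0.ne'
  induction i using Nat.strong_induction_on with
  | _ i ih =>
    intro j
    match i, ih with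
    | 0, _ => exact G_row h0 h1 j
    | 1, _ =>
      cases j with
      | zero => rw [G_symm, G_row h0 h1]; simp
      | succ j =>
        have e1 := G_succ h0 h1 0 0 j
        have e2 := G_succ_zero h0 h1 0 (j + 1)
        rw [G_symm, e2, G_symm r 0 (j+1) 1, G_symm r 0 (j+1) 0, G_row h0 h1, G_row h0 h1,
          G_row h0 h1] at e1
        apply mul_left_cancel₀ hr
        rcases Nat.eq_zero_or_pos j with rfl | hj
        · norm_num only [if_true, if_false] at e1 ⊢
          linear_combination e1
        · have x1 : (0 : ℕ) ≠ j := by omega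
          have x2 : (1 : ℕ) ≠ j + 1 := by omega
          have x3 : (0 : ℕ) ≠ j + 1 := by omega
          have x4 : (0 : ℕ) ≠ j + 2 := by omega
          simp only [x1, x2, x3, x4, if_false] at *
          linear_combination e1
    | (m + 2), ih =>
      cases j with
      | zero => rw [G_symm, G_row h0 h1]; simp
      | succ j =>
        have e1 := G_succ h0 h1 0 (m + 1) j
        have e2 := G_succ h0 h1 0 (j + 1) m
        rw [G_symm, e2, G_symm r 0 (j+1) (m+2), G_symm r 0 (j+1) m, ih m (by omega),
          ih (m + 1) (by omega), ih (m + 1) (by omega)] at e1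
        apply mul_left_cancel₀ hr
        have x1 : (m = j + 1) ↔ (m + 1 = j + 2) := by omega
        have x2 : (m + 1 = j) ↔ (m + 2 = j + 1) := by omega
        simp only [x1, x2] at *
        linear_combination e1

noncomputable def Q (r : ℝ) (n i j : ℕ) : ℝ :=
  (2 / π) * (r ^ j / r ^ i) * G r n i j + (1 + r ^ 2) ^ n * ((1 - r ^ 2) * (r ^ 2) ^ j)

lemma Q_nonneg {r : ℝ} (h0 : 0 < r) (h1 : r < 1) (n i : ℕ) : ∀ j, 0 ≤ Q r n i j := by
  induction n with
  | zero =>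
    intro j
    have : Q r 0 i j = if i = j then 1 else 0 := by
      unfold Q
      rw [G_base h0 h1]
      have := Real.pi_pos.ne'
      have := h0.ne'
      split_ifs with h
      · subst h; field_simp; ring
      · field_simp; ring
    rw [this]; split_ifs <;> norm_num
  | succ n ih =>
    intro j
    cases j with
    | zero =>
      have : Q r (n + 1) i 0 = Q r n i 1 + Q r n i 0 := by
        unfold Q
        rw [G_succ_zero h0 h1]; ring
      rw [this]; exact add_nonneg (ih _) (ih _)
    | succ j =>
      have : Q r (n + 1) i (j + 1) = Q r n i (j + 2) + r ^ 2 * Q r n i j := by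
        unfold Q
        rw [G_succ h0 h1]; ring
      rw [this]; exact add_nonneg (ih _) (mul_nonneg (sq_nonneg _) (ih _))

lemma A_bound {r : ℝ} (h0 : 0 < r) (h1 : r < 1) (k : ℕ) (y : ℝ) : |A r k y| ≤ 2 := by
  unfold A
  have a1 := abs_le.1 (Real.abs_sin_le_one (k * y))
  have a2 := abs_le.1 (Real.abs_sin_le_one ((k + 1) * y))
  rw [abs_le]
  constructor <;> nlinarith

lemma hasSum_G {r : ℝ} (h0 : 0 < r) (h1 : r < 1) (i j : ℕ) (s : ℝ) (hs : 0 ≤ s) :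
    HasSum (fun n : ℕ => s ^ n / (n.factorial : ℝ) * G r n i j)
      (∫ y in (0:ℝ)..π, Real.exp (s * (2 * r * Real.cos y)) / g r y * (A r i y * A r j y)) := by
  have hr : 0 < (1 - r) ^ 2 := by
    have : 0 < 1 - r := by linarith
    positivity
  have key := intervalIntegral.hasSum_integral_of_dominated_convergence (μ := volume)
    (a := 0) (b := π)
    (F := fun (n : ℕ) y => s ^ n / (n.factorial : ℝ) *
      ((2 * r * Real.cos y) ^ n / g r y * (A r i y * A r j y)))
    (f := fun y => Real.exp (s * (2 * r * Real.cos y)) / g r y * (A r i y * A r j y))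
    (fun n _ => (s * 2) ^ n / (n.factorial : ℝ) * (((1 - r) ^ 2)⁻¹ * 4)) ?_ ?_ ?_ ?_ ?_
  · simpa [G, intervalIntegral.integral_const_mul] using key
  · intro n
    exact (continuous_const.mul (G_cont h0 h1 n i j)).aestronglyMeasurable
  · intro n
    refine Eventually.of_forall fun y _ => ?_
    have a1 : |(2 * r * Real.cos y) ^ n| ≤ 2 ^ n := by
      rw [abs_pow]
      apply pow_le_pow_left₀ (abs_nonneg _)
      rw [abs_mul, abs_of_pos (by positivity : (0:ℝ) < 2 * r)]
      nlinarith [Real.abs_cos_le_one y, abs_nonneg (Real.cos y)]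
    have a3 : |g r y|⁻¹ ≤ ((1 - r) ^ 2)⁻¹ := by
      apply inv_anti₀ hr
      rw [abs_of_nonneg (g_pos h0 h1 y).le]
      exact g_lower h0 y
    have a4 : |A r i y * A r j y| ≤ 4 := by
      rw [abs_mul]
      nlinarith [A_bound h0 h1 i y, A_bound h0 h1 j y, abs_nonneg (A r i y), abs_nonneg (A r j y)]
    have hsn : 0 ≤ s ^ n / (n.factorial : ℝ) := by positivity
    rw [Real.norm_eq_abs, abs_mul, abs_of_nonneg hsn, abs_mul, abs_div, div_eq_mul_inv _ |g r y|]
    calc s ^ n / (n.factorial : ℝ) * (|(2 * r * Real.cos y) ^ n| * |g r y|⁻¹ * |A r i y * A r j y|)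
        ≤ s ^ n / (n.factorial : ℝ) * (2 ^ n * ((1 - r) ^ 2)⁻¹ * 4) := by gcongr
      _ = _ := by rw [mul_pow]; ring
  · refine Eventually.of_forall fun y _ => ?_
    exact (Real.summable_pow_div_factorial (s * 2)).mul_right _
  · exact intervalIntegrable_const
  · refine Eventually.of_forall fun y _ => ?_
    have := (NormedSpace.expSeries_div_hasSum_exp (s * (2 * r * Real.cos y)))
    rw [← Real.exp_eq_exp_ℝ] at this
    have h2 := this.mul_right ((g r y)⁻¹ * (A r i y * A r j y))
    rw [← mul_assoc (Real.exp _), ← div_eq_mul_inv] at h2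
    have h3 : (fun n : ℕ => s ^ n / (n.factorial : ℝ) *
        ((2 * r * Real.cos y) ^ n / g r y * (A r i y * A r j y))) =
        fun n : ℕ => (s * (2 * r * Real.cos y)) ^ n / (n.factorial : ℝ) *
          ((g r y)⁻¹ * (A r i y * A r j y)) := by
      funext n; rw [mul_pow s]; ring
    rw [h3]
    exact h2

lemma main {r : ℝ} (h0 : 0 < r) (h1 : r < 1) (i j : ℕ) (s : ℝ) (hs : 0 ≤ s) :
    0 ≤ (2 / π) * (r ^ j / r ^ i) *
      (∫ y in (0:ℝ)..π, Real.exp (-(s * g r y)) / g r y * (A r i y * A r j y)) +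
      (1 - r ^ 2) * (r ^ 2) ^ j := by
  have hA := (hasSum_G h0 h1 i j s hs).mul_left ((2 / π) * (r ^ j / r ^ i))
  have hB := (NormedSpace.expSeries_div_hasSum_exp (s * (1 + r ^ 2)))
  rw [← Real.exp_eq_exp_ℝ] at hB
  have hC := hA.add (hB.mul_right ((1 - r ^ 2) * (r ^ 2) ^ j))
  have hnn := hC.nonneg (fun n => by
    have := mul_nonneg (by positivity : 0 ≤ s ^ n / (n.factorial : ℝ)) (Q_nonneg h0 h1 n i j)
    convert this using 1
    unfold Q; rw [mul_pow]; ring)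
  have e : (∫ y in (0:ℝ)..π, Real.exp (-(s * g r y)) / g r y * (A r i y * A r j y)) =
      Real.exp (-(s * (1 + r ^ 2))) *
      ∫ y in (0:ℝ)..π, Real.exp (s * (2 * r * Real.cos y)) / g r y * (A r i y * A r j y) := by
    rw [← intervalIntegral.integral_const_mul]
    congr 1; ext y
    have : -(s * g r y) = -(s * (1 + r ^ 2)) + s * (2 * r * Real.cos y) := by unfold g; ring
    rw [this, Real.exp_add]; ring
  rw [e]
  have hm := mul_nonneg (Real.exp_pos (-(s * (1 + r ^ 2)))).le hnn
  have he : Real.exp (-(s * (1 + r ^ 2))) * Real.exp (s * (1 + r ^ 2)) = 1 := by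
    rw [← Real.exp_add]; simp
  refine hm.trans_eq ?_
  linear_combination ((1 - r ^ 2) * (r ^ 2) ^ j) * he

end PQ

/-- The transient probabilities are nonnegative. -/
theorem pq_nonneg (lam mu : ℝ) (hlam : 0 < lam) (hmu : 0 < mu)
    (hρ : lam / mu < 1) (i j : ℕ) (t : ℝ) (ht : 0 ≤ t) :
    0 ≤ pq lam mu i j t := by
  have hp : 0 < lam / mu := div_pos hlam hmu
  unfold pq
  generalize lam / mu = ρ at *
  have h0 : 0 < Real.sqrt ρ := Real.sqrt_pos.2 hp
  have h1 : Real.sqrt ρ < 1 := by rw [Real.sqrt_lt' one_pos]; simpa using hρ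
  have hsq : Real.sqrt ρ ^ 2 = ρ := Real.sq_sqrt hp.le
  have h := PQ.main h0 h1 i j (mu * t) (by positivity)
  have hg : ∀ y, PQ.g (Real.sqrt ρ) y = gam ρ y := fun y => by unfold PQ.g gam; rw [hsq]
  have ha : ∀ k y, PQ.A (Real.sqrt ρ) k y = aco ρ k y := fun k y => rfl
  have hpow : ρ ^ (((j : ℝ) - (i : ℝ)) / 2) = Real.sqrt ρ ^ j / Real.sqrt ρ ^ i := by
    rw [← Real.rpow_natCast, ← Real.rpow_natCast, ← Real.rpow_sub h0, Real.sqrt_eq_rpow,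
      ← Real.rpow_mul hp.le]
    congr 1; ring
  simp only [hg, ha, hsq] at h
  rw [hpow]
  exact h
end

section
/- Let λ, μ > 0 with ρ = λ/μ < 1, let i ≥ 0 be an integer, and let t ≥ 0. Then the series ∑_{j=1}^∞ j·p_{ij}(t) converges and equals EL_i(t); that is, ∑_{j=1}^∞ j·[(2/π)·ρ^{(j−i)/2}·∫₀^π e^{−μ t γ(y)}/γ(y) · a_i(y)·a_j(y) dy + (1−ρ)·ρ^j] = (2/π)·ρ^{(1−i)/2}·∫₀^π e^{−μ t γ(y)}/γ(y)² · a_i(y)·sin(y) dy + ρ/(1−ρ). -/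
open Real MeasureTheory Set Filter

lemma gam_pos_aux {ρ : ℝ} (h0 : 0 < ρ) (h1 : ρ < 1) (y : ℝ) : 0 < gam ρ y := by
  unfold gam
  have hs : Real.sqrt ρ ^ 2 = ρ := Real.sq_sqrt h0.le
  have hp : 0 < Real.sqrt ρ := Real.sqrt_pos.2 h0
  have hl : Real.sqrt ρ < 1 := by nlinarith
  have hc := Real.cos_le_one y
  nlinarith [mul_le_mul_of_nonneg_left hc hp.le, sq_pos_of_pos (sub_pos.2 hl)]

lemma hasSum_pow_sin {r : ℝ} (h0 : 0 < r) (h1 : r < 1) (y : ℝ) :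
    HasSum (fun j : ℕ => r ^ j * Real.sin (j * y))
      (r * Real.sin y / (1 + r ^ 2 - 2 * r * Real.cos y)) := by
  have hn : ‖(r : ℂ) * Complex.exp (y * Complex.I)‖ < 1 := by
    rw [norm_mul, Complex.norm_exp_ofReal_mul_I, mul_one, Complex.norm_real, Real.norm_eq_abs,
      abs_of_pos h0]
    exact h1
  have h := Complex.hasSum_im (hasSum_geometric_of_norm_lt_one hn)
  convert h using 1
  · funext j
    have : ((j : ℂ) * (y * Complex.I)) = ((j * y : ℝ) : ℂ) * Complex.I := by push_cast; ring
    rw [mul_pow, ← Complex.exp_nat_mul, this, ← Complex.ofReal_pow, Complex.im_ofReal_mul,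
      Complex.exp_ofReal_mul_I_im]
  · have hre : (1 - (r : ℂ) * Complex.exp (y * Complex.I)).re = 1 - r * Real.cos y := by
      rw [Complex.sub_re, Complex.re_ofReal_mul, Complex.exp_ofReal_mul_I_re, Complex.one_re]
    have him : (1 - (r : ℂ) * Complex.exp (y * Complex.I)).im = - (r * Real.sin y) := by
      rw [Complex.sub_im, Complex.im_ofReal_mul, Complex.exp_ofReal_mul_I_im, Complex.one_im,
        zero_sub]
    rw [Complex.inv_im, Complex.normSq_apply, hre, him, neg_neg]
    congr 1
    linear_combination (-r ^ 2) * Real.sin_sq_add_cos_sq y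

lemma hasSum_aco {ρ : ℝ} (h0 : 0 < ρ) (h1 : ρ < 1) (y : ℝ) :
    HasSum (fun j : ℕ => (j : ℝ) * Real.sqrt ρ ^ j * aco ρ j y)
      (Real.sqrt ρ * Real.sin y / gam ρ y) := by
  have hs : Real.sqrt ρ ^ 2 = ρ := Real.sq_sqrt h0.le
  have hp : 0 < Real.sqrt ρ := Real.sqrt_pos.2 h0
  have hl : Real.sqrt ρ < 1 := by nlinarith
  have hB := hasSum_pow_sin hp hl y
  have hg : gam ρ y = 1 + Real.sqrt ρ ^ 2 - 2 * Real.sqrt ρ * Real.cos y := by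
    rw [hs]; rfl
  rw [← hg] at hB
  set r := Real.sqrt ρ with hr
  have hsum : Summable (fun j : ℕ => (j : ℝ) * r ^ j * Real.sin (j * y)) := by
    have hm : Summable (fun j : ℕ => (j : ℝ) * r ^ j) :=
      (hasSum_coe_mul_geometric_of_norm_lt_one
        (by rw [Real.norm_eq_abs, abs_of_pos hp]; exact hl)).summable
    refine Summable.of_norm_bounded hm (fun j => ?_)
    rw [norm_mul, Real.norm_eq_abs, Real.norm_eq_abs, abs_of_nonneg (by positivity)]
    exact mul_le_of_le_one_right (by positivity) (Real.abs_sin_le_one _)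
  have hF := hsum.hasSum
  have hF1 := (hasSum_nat_add_iff' 1).2 hF
  have hB1 := (hasSum_nat_add_iff' 1).2 hB
  have := (hF.sub hF1).add hB1
  convert! this using 1
  · funext j
    simp only [aco, ← hr]
    push_cast
    ring
  · simp

theorem pq_mean_hasSum_EL (lam mu : ℝ) (hlam : 0 < lam) (hmu : 0 < mu)
    (hρ : lam / mu < 1) (i : ℕ) (t : ℝ) (ht : 0 ≤ t) :
    HasSum (fun j : ℕ => (j : ℝ) * pq lam mu i j t) (EL lam mu i t) := by
  have h0 : 0 < lam / mu := div_pos hlam hmu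
  unfold pq EL
  generalize lam / mu = ρ at *
  have hs : Real.sqrt ρ ^ 2 = ρ := Real.sq_sqrt h0.le
  have hp : 0 < Real.sqrt ρ := Real.sqrt_pos.2 h0
  have hl : Real.sqrt ρ < 1 := by nlinarith
  have hgc : Continuous (gam ρ) := by unfold gam; fun_prop
  have hac : ∀ k, Continuous (aco ρ k) := by intro k; unfold aco; fun_prop
  have hg0 : ∀ y, gam ρ y ≠ 0 := fun y => (gam_pos_aux h0 hρ y).ne'
  set G : ℝ → ℝ := fun y => Real.exp (-(mu * t * gam ρ y)) / gam ρ y * aco ρ i y with hG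
  have hGc : Continuous G :=
    ((Real.continuous_exp.comp (by fun_prop)).div hgc hg0).mul (hac i)
  have hm : Summable (fun j : ℕ => (j : ℝ) * Real.sqrt ρ ^ j) :=
    (hasSum_coe_mul_geometric_of_norm_lt_one
      (by rw [Real.norm_eq_abs, abs_of_pos hp]; exact hl)).summable
  have habs : ∀ k y, |aco ρ k y| ≤ 2 := by
    intro k y
    unfold aco
    have e1 := abs_le.1 (Real.abs_sin_le_one ((k : ℝ) * y))
    have e2 := abs_le.1 (Real.abs_sin_le_one (((k : ℝ) + 1) * y))
    rw [abs_le]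
    constructor <;> nlinarith
  have hint : HasSum (fun j : ℕ => ∫ y in (0:ℝ)..Real.pi,
      G y * ((j : ℝ) * Real.sqrt ρ ^ j * aco ρ j y))
      (∫ y in (0:ℝ)..Real.pi, G y * (Real.sqrt ρ * Real.sin y / gam ρ y)) := by
    refine intervalIntegral.hasSum_integral_of_dominated_convergence
      (fun j y => |G y| * ((j : ℝ) * Real.sqrt ρ ^ j * 2)) ?_ ?_ ?_ ?_ ?_
    · intro j
      exact (hGc.mul (continuous_const.mul (hac j))).aestronglyMeasurable
    · intro j
      refine Eventually.of_forall fun y _ => ?_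
      rw [Real.norm_eq_abs, abs_mul (G y), abs_mul (_ * _) (aco ρ j y),
        abs_of_nonneg (by positivity : (0:ℝ) ≤ (j : ℝ) * Real.sqrt ρ ^ j)]
      have := habs j y
      gcongr
    · exact Eventually.of_forall fun y _ => (hm.mul_right 2).mul_left _
    · simp_rw [tsum_mul_left]
      exact (hGc.abs.mul continuous_const).intervalIntegrable _ _
    · exact Eventually.of_forall fun y _ => (hasSum_aco h0 hρ y).mul_left _
  have h2 := (hasSum_coe_mul_geometric_of_norm_lt_one (r := ρ)
      (by rw [Real.norm_eq_abs, abs_of_pos h0]; exact hρ)).mul_left (1 - ρ)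
  have h3 := (hint.mul_left ((2 / Real.pi) * ρ ^ (-(i : ℝ) / 2))).add h2
  convert! h3 using 1
  · funext j
    have e : (fun y => G y * ((j : ℝ) * Real.sqrt ρ ^ j * aco ρ j y)) = fun y =>
        ((j : ℝ) * Real.sqrt ρ ^ j) * (Real.exp (-(mu * t * gam ρ y)) / gam ρ y *
          (aco ρ i y * aco ρ j y)) := by
      funext y; simp only [hG]; ring
    have e2 : ρ ^ (((j : ℝ) - i) / 2) = ρ ^ (-(i : ℝ) / 2) * Real.sqrt ρ ^ j := by
      rw [Real.sqrt_eq_rpow, ← Real.rpow_natCast, ← Real.rpow_mul h0.le, ← Real.rpow_add h0]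
      congr 1; ring
    rw [e, intervalIntegral.integral_const_mul, e2]
    ring
  · have e : (fun y => G y * (Real.sqrt ρ * Real.sin y / gam ρ y)) = fun y =>
        Real.sqrt ρ * (Real.exp (-(mu * t * gam ρ y)) / gam ρ y ^ 2 *
          (aco ρ i y * Real.sin y)) := by
      funext y; simp only [hG]
      have := hg0 y
      field_simp
    have e2 : ρ ^ ((1 - (i : ℝ)) / 2) = ρ ^ (-(i : ℝ) / 2) * Real.sqrt ρ := by
      rw [Real.sqrt_eq_rpow, ← Real.rpow_add h0]
      congr 1; ring
    rw [e, intervalIntegral.integral_const_mul, e2]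
    have : 1 - ρ ≠ 0 := (sub_pos.2 hρ).ne'
    have e3 : ρ / (1 - ρ) = (1 - ρ) * (ρ / (1 - ρ) ^ 2) := by field_simp
    rw [e3]
    ring
end

section
/- Let λ = 3 and μ = 4 (so ρ = 3/4). Then ETT(12, 10) < ETT(10, 12), where ETT(a, b) = (a+2)/μ + (1/μ)·∫₀^∞ f_{a+1}(t)·EL_b(t) dt with f_{a+1}(t) = μ^{a+1} t^a e^{−μ t}/a! and EL_b given by the explicit integral formula. That is, joining the longer queue (12 customers) first yields a strictly smaller expected total time than joining the shorter queue (10 customers) first. -/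
open Real MeasureTheory Set Filter

/-- Table (scaled by 1000) of a supersolution for the idle-time correction. -/
def tab : List (List ℕ) :=
  [[0, 0, 0, 0, 0, 0, 0, 0, 0, 0, 0, 5],
   [695, 286, 118, 50, 21, 10, 5, 3, 3, 3, 4, 7],
   [1246, 645, 321, 156, 75, 37, 19, 11, 8, 7, 7, 10],
   [1720, 1017, 572, 310, 164, 87, 46, 26, 17, 12, 12, 14],
   [2148, 1383, 848, 500, 286, 161, 90, 52, 32, 22, 18, 19],
   [2545, 1739, 1136, 714, 435, 259, 152, 90, 55, 36, 28, 26],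
   [2920, 2085, 1430, 946, 606, 379, 232, 142, 88, 57, 41, 35],
   [3279, 2422, 1726, 1189, 795, 518, 330, 208, 132, 86, 60, 47],
   [3625, 2751, 2022, 1440, 997, 673, 444, 289, 187, 123, 85, 63],
   [3961, 3073, 2316, 1697, 1210, 842, 573, 384, 254, 170, 116, 84],
   [4289, 3389, 2609, 1957, 1431, 1022, 715, 491, 333, 226, 156, 112],
   [4609, 3700, 2900, 2219, 1659, 1212, 868, 610, 424, 293, 205, 150],
   [4923, 4006, 3189, 2483, 1892, 1411, 1031, 741, 525, 371, 265, 200],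
   [5232, 4308, 3477, 2748, 2129, 1616, 1204, 882, 638, 459, 337, 267]]

def T (n b : ℕ) : ℕ := (tab.getD n []).getD b 0

theorem T_zero : ∀ n < 13, 4000 + 3 * T (n+1) 1 + 4 * T n 0 ≤ 7 * T (n+1) 0 := by decide

theorem T_mid : ∀ n < 13, ∀ b < 10,
    3 * T (n+1) (b+2) + 4 * T (n+1) b + 4 * T n (b+1) ≤ 11 * T (n+1) (b+1) := by decide

theorem T_end : ∀ n < 13, 4 * T (n+1) 10 + 4 * T n 11 ≤ 9 * T (n+1) 11 := by decide

theorem T_tail : ∀ n < 13, 4 * T n 11 ≤ 3 * T (n+1) 11 := by decide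

/-- the supersolution -/
noncomputable def EE (n b : ℕ) : ℝ := (T n (min b 11) : ℝ) / 1000 * (2/3 : ℝ)^(b - 11)

theorem EE_nonneg (n b : ℕ) : 0 ≤ EE n b := by unfold EE; positivity

theorem EE_zero (n : ℕ) (hn : n < 13) : 1 + 3/4 * EE (n+1) 1 + EE n 0 ≤ 7/4 * EE (n+1) 0 := by
  have h := T_zero n hn
  have h' : (4000 + 3 * T (n+1) 1 + 4 * T n 0 : ℝ) ≤ 7 * T (n+1) 0 := by exact_mod_cast h
  simp [EE]
  linarith

theorem EE_succ (n : ℕ) (hn : n < 13) (b : ℕ) :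
    3/4 * EE (n+1) (b+2) + EE (n+1) b + EE n (b+1) ≤ 11/4 * EE (n+1) (b+1) := by
  rcases lt_trichotomy b 10 with hb | hb | hb
  · have h := T_mid n hn b hb
    have h' : (3 * T (n+1) (b+2) + 4 * T (n+1) b + 4 * T n (b+1) : ℝ) ≤ 11 * T (n+1) (b+1) := by
      exact_mod_cast h
    have e1 : min (b+2) 11 = b+2 := by omega
    have e2 : min (b+1) 11 = b+1 := by omega
    have e3 : min b 11 = b := by omega
    have f1 : b + 2 - 11 = 0 := by omega
    have f2 : b + 1 - 11 = 0 := by omega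
    have f3 : b - 11 = 0 := by omega
    simp only [EE, e1, e2, e3, f1, f2, f3]
    linarith
  · subst hb
    have h' : (4 * T (n+1) 10 + 4 * T n 11 : ℝ) ≤ 9 * T (n+1) 11 := by exact_mod_cast T_end n hn
    simp [EE]
    linarith
  · obtain ⟨c, rfl⟩ : ∃ c, b = 11 + c := ⟨b - 11, by omega⟩
    have h' : (4 * T n 11 : ℝ) ≤ 3 * T (n+1) 11 := by exact_mod_cast T_tail n hn
    have e1 : min (11+c+2) 11 = 11 := by omega
    have e2 : min (11+c+1) 11 = 11 := by omega
    have e3 : min (11+c) 11 = 11 := by omega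
    have f1 : 11+c + 2 - 11 = c+2 := by omega
    have f2 : 11+c + 1 - 11 = c+1 := by omega
    have f3 : 11+c - 11 = c := by omega
    simp only [EE, e1, e2, e3, f1, f2, f3, pow_succ]
    have hp : (0:ℝ) ≤ (2/3)^c := by positivity
    nlinarith [mul_le_mul_of_nonneg_left h' hp]

theorem nonneg_of_super (D c : ℝ) (z : ℕ → ℝ) (hD : 7/4 ≤ D) (hc0 : 0 ≤ c) (hc : c ≤ 1/2)
    (hB : ∃ B, ∀ b, -(B * (6/5 : ℝ)^b) ≤ z b)
    (h0 : c * z 1 ≤ z 0)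
    (hs : ∀ b, 3/4 * z (b+2) + z b ≤ D * z (b+1)) (b : ℕ) : 0 ≤ z b := by
  obtain ⟨B, hB⟩ := hB
  have hB' : ∀ b, -(|B| * (6/5 : ℝ)^b) ≤ z b := fun b => by
    have := mul_le_mul_of_nonneg_right (le_abs_self B) (show (0:ℝ) ≤ (6/5)^b by positivity)
    linarith [hB b]
  have key : ∀ k : ℕ, ∀ b, -(|B| * (0.991:ℝ)^k * (6/5 : ℝ)^b) ≤ z b := by
    intro k
    induction k with
    | zero => simpa using hB'
    | succ k ih =>
      have hM : 0 ≤ |B| * (0.991:ℝ)^k := by positivity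
      rw [pow_succ, ← mul_assoc]
      generalize |B| * (0.991:ℝ)^k = M at ih hM
      intro b
      cases b with
      | zero =>
        have := ih 1
        have h2 := mul_le_mul_of_nonneg_left this hc0
        simp at h2 ⊢
        nlinarith
      | succ b =>
        have h2 := ih (b+2)
        have h1 := ih b
        have h3 := hs b
        have hp : (0:ℝ) ≤ M * (6/5)^b := by positivity
        rw [pow_succ] at h2 ⊢
        rw [pow_succ] at h2
        by_contra hcon
        push Not at hcon
        have hneg : z (b+1) ≤ 0 := by nlinarith
        have : D * z (b+1) ≤ 7/4 * z (b+1) := by nlinarith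
        nlinarith
  have lim : Tendsto (fun k : ℕ => -(|B| * (0.991:ℝ)^k * (6/5 : ℝ)^b)) atTop (nhds 0) := by
    have := (tendsto_pow_atTop_nhds_zero_of_lt_one (r := (0.991:ℝ)) (by norm_num) (by norm_num))
    simpa using ((this.const_mul |B|).mul_const ((6/5 : ℝ)^b)).neg
  exact le_of_tendsto' lim (fun k => key k b)

theorem eq_of_super (D c : ℝ) (z w : ℕ → ℝ) (hD : 7/4 ≤ D) (hc0 : 0 ≤ c) (hc : c ≤ 1/2)
    (hB : ∃ B, ∀ b, |z b| ≤ B * (6/5 : ℝ)^b) (hB' : ∃ B, ∀ b, |w b| ≤ B * (6/5 : ℝ)^b)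
    (h0 : z 0 - w 0 = c * (z 1 - w 1))
    (hs : ∀ b, 3/4 * (z (b+2) - w (b+2)) + (z b - w b) = D * (z (b+1) - w (b+1))) (b : ℕ) :
    z b = w b := by
  obtain ⟨B, hB⟩ := hB
  obtain ⟨B', hB'⟩ := hB'
  apply le_antisymm
  · have := nonneg_of_super D c (fun b => w b - z b) hD hc0 hc ⟨B + B', fun b => by
      have := abs_le.1 (hB b); have := abs_le.1 (hB' b); (try dsimp only); linarith⟩
      (by (try dsimp only); linarith) (fun b => by (try dsimp only); linarith [hs b]) b
    linarith
  · have := nonneg_of_super D c (fun b => z b - w b) hD hc0 hc ⟨B + B', fun b => by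
      have := abs_le.1 (hB b); have := abs_le.1 (hB' b); (try dsimp only); linarith⟩
      (by (try dsimp only); linarith) (fun b => by (try dsimp only); linarith [hs b]) b
    linarith

theorem lin_bound (b : ℕ) : (b : ℝ) ≤ 5 * (6/5 : ℝ)^b := by
  have := one_add_mul_le_pow (a := (1/5:ℝ)) (by norm_num) b
  norm_num at this
  linarith

/-- the constant sqrt (3/4) -/
noncomputable def kap : ℝ := Real.sqrt (3/4)

theorem kap_sq : kap * kap = 3/4 := Real.mul_self_sqrt (by norm_num)
theorem kap_pos : 0 < kap := Real.sqrt_pos.2 (by norm_num)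
theorem kap_lt : kap < 0.8675 := by nlinarith [kap_sq, kap_pos]
theorem kap_gt : 5/6 < kap := by nlinarith [kap_sq, kap_pos]

/-- gam at 3/4 -/
noncomputable def G (y : ℝ) : ℝ := 7/4 - 2 * kap * Real.cos y

theorem gam_eq (y : ℝ) : gam (3/4) y = G y := by unfold gam G kap; ring

theorem G_gt (y : ℝ) : 1/100 ≤ G y := by
  unfold G
  nlinarith [Real.cos_le_one y, kap_pos, kap_lt]

theorem G_pos (y : ℝ) : 0 < G y := lt_of_lt_of_le (by norm_num) (G_gt y)

theorem G_cont : Continuous G := by unfold G; fun_prop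

/-- normalised sine coefficients -/
noncomputable def N (w : ℝ → ℝ) (b : ℕ) : ℝ :=
  (2 / Real.pi) * (kap / kap ^ b) *
    ∫ y in (0:ℝ)..Real.pi, w y * (Real.sin ((b:ℝ) * y) * Real.sin y)

theorem N_zero (w : ℝ → ℝ) : N w 0 = 0 := by simp [N]

theorem N_bound (w : ℝ → ℝ) (M : ℝ) (hM : ∀ y, |w y| ≤ M) : ∃ B, ∀ b, |N w b| ≤ B * (6/5:ℝ)^b := by
  refine ⟨(2 / Real.pi) * kap * (M * |Real.pi - 0|), fun b => ?_⟩
  have h1 : ‖∫ y in (0:ℝ)..Real.pi, w y * (Real.sin ((b:ℝ) * y) * Real.sin y)‖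
      ≤ M * |Real.pi - 0| := by
    apply intervalIntegral.norm_integral_le_of_norm_le_const
    intro y _
    rw [Real.norm_eq_abs, abs_mul, abs_mul]
    have h2 := Real.abs_sin_le_one ((b:ℝ) * y)
    have h3 := Real.abs_sin_le_one y
    have h4 : |Real.sin ((b:ℝ) * y)| * |Real.sin y| ≤ 1 := mul_le_one₀ h2 (abs_nonneg _) h3
    calc _ ≤ |w y| * 1 := mul_le_mul_of_nonneg_left h4 (abs_nonneg _)
      _ ≤ M := by simpa using hM y
  have hk := kap_pos
  have h5 : kap / kap^b ≤ kap * (6/5:ℝ)^b := by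
    rw [div_eq_mul_inv, ← inv_pow]
    gcongr
    rw [inv_le_comm₀ hk (by norm_num)]
    have := kap_gt
    norm_num; linarith
  rw [N, abs_mul, abs_mul, abs_of_pos (show 0 < 2/Real.pi by positivity),
    abs_of_pos (show 0 < kap/kap^b by positivity)]
  rw [Real.norm_eq_abs] at h1
  calc _ ≤ 2 / Real.pi * (kap * (6/5:ℝ)^b) * (M * |Real.pi - 0|) := by gcongr
    _ = _ := by ring

theorem ii (w : ℝ → ℝ) (hw : Continuous w) (b : ℕ) :
    IntervalIntegrable (fun y => w y * (Real.sin ((b:ℝ) * y) * Real.sin y)) volume 0 Real.pi := by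
  apply Continuous.intervalIntegrable
  fun_prop

theorem N_add (w v : ℝ → ℝ) (hw : Continuous w) (hv : Continuous v) (b : ℕ) :
    N (fun y => w y + v y) b = N w b + N v b := by
  unfold N
  rw [← mul_add, ← intervalIntegral.integral_add (ii w hw b) (ii v hv b)]
  congr 1
  apply intervalIntegral.integral_congr
  intro y _
  (try dsimp only)
  ring

theorem N_gam (w : ℝ → ℝ) (hw : Continuous w) (b : ℕ) :
    N (fun y => G y * w y) (b+1) = 7/4 * N w (b+1) - 3/4 * N w (b+2) - N w b := by
  have hk := kap_pos
  have key : (∫ y in (0:ℝ)..Real.pi, (G y * w y) * (Real.sin (((b+1:ℕ):ℝ) * y) * Real.sin y))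
     = 7/4 * (∫ y in (0:ℝ)..Real.pi, w y * (Real.sin (((b+1:ℕ):ℝ) * y) * Real.sin y))
      - kap * (∫ y in (0:ℝ)..Real.pi, w y * (Real.sin (((b+2:ℕ):ℝ) * y) * Real.sin y))
      - kap * (∫ y in (0:ℝ)..Real.pi, w y * (Real.sin ((b:ℝ) * y) * Real.sin y)) := by
    rw [← intervalIntegral.integral_const_mul, ← intervalIntegral.integral_const_mul,
      ← intervalIntegral.integral_const_mul, ← intervalIntegral.integral_sub
        ((ii w hw _).const_mul _) ((ii w hw _).const_mul _), ← intervalIntegral.integral_sub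
        (((ii w hw _).const_mul _).sub ((ii w hw _).const_mul _)) ((ii w hw _).const_mul _)]
    apply intervalIntegral.integral_congr
    intro y _
    (try dsimp only)
    have e1 : ((b+2:ℕ):ℝ) * y = ((b+1:ℕ):ℝ) * y + y := by push_cast; ring
    have e2 : (b:ℝ) * y = ((b+1:ℕ):ℝ) * y - y := by push_cast; ring
    rw [e1, e2, Real.sin_add, Real.sin_sub, G]
    ring
  unfold N
  rw [key]
  have e : (3/4:ℝ) = kap * kap := kap_sq.symm
  rw [e]
  field_simp
  ring

theorem N_one (b : ℕ) : N (fun _ => 1) (b+1) = if b = 0 then 1 else 0 := by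
  have hk := kap_pos
  have hpi := Real.pi_pos
  have h1 : ∀ y : ℝ, 1 * (Real.sin (((b+1:ℕ):ℝ) * y) * Real.sin y)
      = 1/2 * (Real.cos ((b:ℝ) * y)) - 1/2 * Real.cos (((b+2:ℕ):ℝ) * y) := by
    intro y
    have e1 : ((b+2:ℕ):ℝ) * y = ((b+1:ℕ):ℝ) * y + y := by push_cast; ring
    have e2 : (b:ℝ) * y = ((b+1:ℕ):ℝ) * y - y := by push_cast; ring
    rw [e1, e2, Real.cos_add, Real.cos_sub]
    ring
  have h2 : ∀ m : ℕ, (∫ y in (0:ℝ)..Real.pi, Real.cos (((m+1:ℕ):ℝ) * y)) = 0 := by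
    intro m
    have hm : ((m+1:ℕ):ℝ) ≠ 0 := by positivity
    rw [intervalIntegral.integral_comp_mul_left (fun y => Real.cos y) hm, integral_cos]
    simp only [mul_zero, Real.sin_zero, Real.sin_nat_mul_pi]
    simp
  unfold N
  simp_rw [h1]
  rw [intervalIntegral.integral_sub (by apply Continuous.intervalIntegrable; fun_prop)
    (by apply Continuous.intervalIntegrable; fun_prop), intervalIntegral.integral_const_mul,
    intervalIntegral.integral_const_mul, h2 (b+1)]
  cases b with
  | zero => simp; field_simp
  | succ b => rw [h2 b]; simp

theorem inv_bound (w : ℝ → ℝ) (M : ℝ) (hM : ∀ y, |w y| ≤ M) (y : ℝ) : |w y / G y| ≤ M * 100 := by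
  have h := G_gt y
  have h0 := G_pos y
  rw [abs_div, abs_of_pos h0, div_le_iff₀ h0]
  nlinarith [hM y, abs_nonneg (w y)]

theorem N_inv (b : ℕ) : N (fun y => 1 / G y) b = if b = 0 then 0 else 1 := by
  have hc : Continuous (fun y => 1 / G y) :=
    continuous_const.div G_cont (fun y => (G_pos y).ne')
  refine eq_of_super (7/4) 0 _ (fun b => if b = 0 then 0 else 1) le_rfl le_rfl (by norm_num)
    (N_bound _ (1*100) (inv_bound (fun _ => 1) 1 (by simp))) ⟨1, fun b => ?_⟩ ?_ ?_ b
  · have : (1:ℝ) ≤ (6/5)^b := one_le_pow₀ (by norm_num)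
    (try dsimp only)
    split_ifs <;> simp <;> linarith
  · simp [N_zero]
  · intro b
    have h := N_gam _ hc b
    have e : (fun y => G y * (1 / G y)) = fun _ => 1 := by
      funext y; have := (G_pos y).ne'; field_simp
    rw [e, N_one] at h
    cases b with
    | zero => simp [N_zero] at h ⊢; linarith
    | succ b => simp at h ⊢; linarith

theorem N_inv2 (b : ℕ) : N (fun y => 1 / G y / G y) b = 4 * b := by
  have hc1 : Continuous (fun y => 1 / G y) :=
    continuous_const.div G_cont (fun y => (G_pos y).ne')
  have hc : Continuous (fun y => 1 / G y / G y) :=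
    hc1.div G_cont (fun y => (G_pos y).ne')
  refine eq_of_super (7/4) 0 _ (fun b => 4 * (b:ℝ)) le_rfl le_rfl (by norm_num)
    (N_bound _ (1*100*100) (inv_bound _ _ (inv_bound (fun _ => 1) 1 (by simp))))
      ⟨20, fun b => ?_⟩ ?_ ?_ b
  · have := lin_bound b
    (try dsimp only)
    rw [abs_of_nonneg (by positivity)]
    linarith
  · simp [N_zero]
  · intro b
    have h := N_gam _ hc b
    have e : (fun y => G y * (1 / G y / G y)) = fun y => 1 / G y := by
      funext y; have := (G_pos y).ne'; field_simp
    rw [e, N_inv] at h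
    simp at h ⊢; linarith

/-- the weights -/
noncomputable def wt (n : ℕ) (y : ℝ) : ℝ := 1 / G y / G y / (1 + G y)^n

theorem wt_cont (n : ℕ) : Continuous (wt n) := by
  unfold wt
  refine Continuous.div (Continuous.div (Continuous.div continuous_const G_cont ?_) G_cont ?_)
    ((continuous_const.add G_cont).pow n) ?_
  · exact fun y => (G_pos y).ne'
  · exact fun y => (G_pos y).ne'
  · intro y; have := G_pos y; positivity

theorem wt_bound (n : ℕ) (y : ℝ) : |wt n y| ≤ 1*100*100 := by
  have h := inv_bound _ _ (inv_bound (fun _ => 1) 1 (by simp)) y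
  have h0 := G_pos y
  have h1 : 1 ≤ (1 + G y)^n := one_le_pow₀ (by linarith)
  rw [wt, abs_div, abs_of_pos (show 0 < (1 + G y)^n by positivity)]
  exact (div_le_self (abs_nonneg _) h1).trans h

/-- Expected queue length at an Erlang time -/
noncomputable def J (n b : ℕ) : ℝ := N (wt n) b - 3/4 * N (wt n) (b+1) + 3

theorem J_bound (n : ℕ) : ∃ B, ∀ b, |J n b| ≤ B * (6/5:ℝ)^b := by
  obtain ⟨B, hB⟩ := N_bound (wt n) _ (wt_bound n)
  refine ⟨2 * B + 3, fun b => ?_⟩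
  have h1 := abs_le.1 (hB b)
  have h2 := abs_le.1 (hB (b+1))
  rw [pow_succ] at h2
  have : (1:ℝ) ≤ (6/5)^b := one_le_pow₀ (by norm_num)
  have hB0 := (abs_nonneg _).trans (hB b)
  rw [abs_le, J]
  constructor <;> linarith

theorem J_init (b : ℕ) : J 0 b = b := by
  have : wt 0 = fun y => 1 / G y / G y := by funext y; simp [wt]
  rw [J, this, N_inv2, N_inv2]; push_cast; ring

theorem N_wt (n b : ℕ) :
    N (wt n) (b+1) = 11/4 * N (wt (n+1)) (b+1) - 3/4 * N (wt (n+1)) (b+2) - N (wt (n+1)) b := by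
  have h := N_gam _ (wt_cont (n+1)) b
  have h2 := N_add _ _ (wt_cont (n+1)) (G_cont.mul (wt_cont (n+1))) (b+1)
  have e : (fun y => wt (n+1) y + G y * wt (n+1) y) = wt n := by
    funext y
    have := G_pos y
    have : 1 + G y ≠ 0 := by positivity
    unfold wt
    rw [pow_succ]
    field_simp
  rw [← e]
  rw [show N (fun y => wt (n+1) y + G y * wt (n+1) y) (b+1) =
    N (wt (n+1)) (b+1) + N (fun y => G y * wt (n+1) y) (b+1) from h2]
  rw [h]; ring

theorem J_zero (n : ℕ) : 7/4 * J (n+1) 0 = 3/4 * J (n+1) 1 + J n 0 := by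
  have h := N_wt n 0
  simp only [J, N_zero, zero_add] at h ⊢
  rw [h]; ring

theorem J_succ (n b : ℕ) :
    11/4 * J (n+1) (b+1) = 3/4 * J (n+1) (b+2) + J (n+1) b + J n (b+1) := by
  have h := N_wt n b
  have h1 := N_wt n (b+1)
  simp only [J]
  rw [h, h1]; ring

theorem J_lower (n : ℕ) : ∀ b : ℕ, (b:ℝ) - n/4 ≤ J n b := by
  induction n with
  | zero => intro b; simp [J_init]
  | succ n ih =>
    intro b
    obtain ⟨B, hB⟩ := J_bound (n+1)
    have := nonneg_of_super (11/4) (3/7) (fun b => J (n+1) b - (b - (n+1:ℕ)/4)) (by norm_num)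
      (by norm_num) (by norm_num) ⟨B + 5, fun b => ?_⟩ ?_ ?_ b
    · linarith
    · have := abs_le.1 (hB b)
      have := lin_bound b
      have : (0:ℝ) ≤ ((n+1:ℕ):ℝ)/4 := by positivity
      (try dsimp only); linarith
    · have := J_zero n
      have := ih 0
      (try dsimp only); push_cast at *; linarith
    · intro b
      have := J_succ n b
      have := ih (b+1)
      (try dsimp only); push_cast at *; linarith

theorem J_upper (n : ℕ) (hn : n ≤ 13) : ∀ b : ℕ, J n b ≤ (b:ℝ) - n/4 + EE n b := by
  induction n with
  | zero => intro b; simp [J_init, EE_nonneg]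
  | succ n ih =>
    intro b
    obtain ⟨B, hB⟩ := J_bound (n+1)
    have ih := ih (by omega)
    have := nonneg_of_super (11/4) (3/7) (fun b => (b - (n+1:ℕ)/4 + EE (n+1) b) - J (n+1) b)
      (by norm_num) (by norm_num) (by norm_num) ⟨B + ((n+1:ℕ):ℝ)/4, fun b => ?_⟩ ?_ ?_ b
    · linarith
    · have := abs_le.1 (hB b)
      have h1 : (1:ℝ) ≤ (6/5)^b := one_le_pow₀ (by norm_num)
      have h0 : (0:ℝ) ≤ ((n+1:ℕ):ℝ)/4 := by positivity
      have h2 := EE_nonneg (n+1) b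
      have h3 : (0:ℝ) ≤ b := by positivity
      have := mul_le_mul_of_nonneg_left h1 h0
      (try dsimp only); linarith
    · have := J_zero n
      have := ih 0
      have := EE_zero n (by omega)
      (try dsimp only); push_cast at *; linarith
    · intro b
      have := J_succ n b
      have := ih (b+1)
      have := EE_succ n (by omega) b
      (try dsimp only); push_cast at *; linarith

theorem J_eq (n b : ℕ) : J n b = (2 / Real.pi) * (kap / kap ^ b) *
    (∫ y in (0:ℝ)..Real.pi, wt n y * (aco (3/4) b y * Real.sin y)) + 3 := by
  have hk := kap_pos
  have key : (∫ y in (0:ℝ)..Real.pi, wt n y * (aco (3/4) b y * Real.sin y))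
     = (∫ y in (0:ℝ)..Real.pi, wt n y * (Real.sin ((b:ℝ) * y) * Real.sin y))
      - kap * (∫ y in (0:ℝ)..Real.pi, wt n y * (Real.sin (((b+1:ℕ):ℝ) * y) * Real.sin y)) := by
    rw [← intervalIntegral.integral_const_mul, ← intervalIntegral.integral_sub
        (ii _ (wt_cont n) _) ((ii _ (wt_cont n) _).const_mul _)]
    apply intervalIntegral.integral_congr
    intro y _
    simp only [aco, kap]
    push_cast
    ring
  rw [J, key, N, N]
  have e : (3/4:ℝ) = kap * kap := kap_sq.symm
  rw [e]
  field_simp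
  ring

theorem rpow_eq (b : ℕ) : ((3:ℝ)/4) ^ ((1 - (b:ℝ))/2) = kap / kap ^ b := by
  have h : kap = (3/4:ℝ) ^ (1/2:ℝ) := by rw [kap, Real.sqrt_eq_rpow]
  have : (1 - (b:ℝ))/2 = 1/2 * (1 - (b:ℝ)) := by ring
  rw [this, Real.rpow_mul (by norm_num), ← h, Real.rpow_sub kap_pos, Real.rpow_one,
    Real.rpow_natCast]

theorem erl_lap (a : ℕ) (g : ℝ) (hg : 0 ≤ g) :
    ∫ t in Set.Ioi (0:ℝ), erl 4 (a+1) t * Real.exp (-(4 * t * g)) = 1 / (1 + g)^(a+1) := by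
  have h := Real.integral_rpow_mul_exp_neg_mul_Ioi (a := (a:ℝ)+1) (r := 4 * (1+g))
    (by positivity) (by positivity)
  have e : ∀ t ∈ Set.Ioi (0:ℝ), erl 4 (a+1) t * Real.exp (-(4 * t * g)) =
      (4^(a+1) / (a.factorial : ℝ)) * (t ^ ((a:ℝ)+1-1) * Real.exp (-(4 * (1+g) * t))) := by
    intro t ht
    rw [add_sub_cancel_right, Real.rpow_natCast, erl, Nat.add_sub_cancel]
    have : Real.exp (-(4 * (1+g) * t)) = Real.exp (-(4*t)) * Real.exp (-(4 * t * g)) := by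
      rw [← Real.exp_add]; congr 1; ring
    rw [this]; ring
  rw [setIntegral_congr_fun measurableSet_Ioi e, integral_const_mul, h, Real.Gamma_nat_eq_factorial]
  have hf : (a.factorial : ℝ) ≠ 0 := by positivity
  have hg' : 1 + g ≠ 0 := by positivity
  have : ((1:ℝ) / (4 * (1+g))) ^ ((a:ℝ)+1) = (1 / (4 * (1+g)))^(a+1) := by
    rw [← Real.rpow_natCast]; push_cast; rfl
  rw [this, div_pow, mul_pow, one_pow]
  field_simp

theorem erl_int (a : ℕ) : IntegrableOn (erl 4 (a+1)) (Set.Ioi 0) := by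
  by_contra h
  have h1 := erl_lap a 0 le_rfl
  simp at h1
  rw [integral_undef h] at h1
  norm_num at h1

theorem erl_nonneg (a : ℕ) (t : ℝ) (ht : 0 ≤ t) : 0 ≤ erl 4 (a+1) t := by
  unfold erl; positivity

theorem erl_cont (a : ℕ) : Continuous (erl 4 (a+1)) := by
  unfold erl; fun_prop

/-- the spatial integrand -/
noncomputable def H (b : ℕ) (y : ℝ) : ℝ := 1 / G y / G y * (aco (3/4) b y * Real.sin y)

theorem H_cont (b : ℕ) : Continuous (H b) := by
  have hc1 : Continuous (fun y => 1 / G y) :=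
    continuous_const.div G_cont (fun y => (G_pos y).ne')
  have hc : Continuous (fun y => 1 / G y / G y) :=
    hc1.div G_cont (fun y => (G_pos y).ne')
  unfold H aco
  exact hc.mul (by fun_prop)

theorem prod_int (a b : ℕ) : Integrable
    (Function.uncurry fun t y => erl 4 (a+1) t * Real.exp (-(4 * t * G y)) * H b y)
    ((volume.restrict (Set.Ioi (0:ℝ))).prod (volume.restrict (Set.Ioc (0:ℝ) Real.pi))) := by
  have hH : Integrable (H b) (volume.restrict (Set.Ioc (0:ℝ) Real.pi)) :=
    ((H_cont b).integrableOn_Icc (a := 0) (b := Real.pi)).mono_set Set.Ioc_subset_Icc_self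
  have h := (erl_int a).integrable.mul_prod hH
  refine h.mono ?_ ?_
  · apply Continuous.aestronglyMeasurable
    have := erl_cont a
    have := H_cont b
    have := G_cont
    unfold Function.uncurry
    fun_prop
  · rw [Measure.prod_restrict]
    filter_upwards [ae_restrict_mem (measurableSet_Ioi.prod measurableSet_Ioc)] with p hp
    have ht : 0 < p.1 := hp.1
    have hG := G_pos p.2
    simp only [Function.uncurry, norm_mul]
    have : ‖Real.exp (-(4 * p.1 * G p.2))‖ ≤ 1 := by
      rw [Real.norm_eq_abs, abs_of_pos (Real.exp_pos _), Real.exp_le_one_iff]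
      have : 0 < 4 * p.1 * G p.2 := by positivity
      linarith
    have h3 : ‖erl 4 (a+1) p.1‖ * ‖Real.exp (-(4 * p.1 * G p.2))‖ ≤ ‖erl 4 (a+1) p.1‖ :=
      mul_le_of_le_one_right (norm_nonneg _) this
    exact mul_le_mul_of_nonneg_right h3 (norm_nonneg _)

theorem main_int (a b : ℕ) :
    ∫ t in Set.Ioi (0:ℝ), erl 4 (a+1) t * EL 3 4 b t = J (a+1) b := by
  have hp := prod_int a b
  have hpi := Real.pi_pos.le
  have hEL : ∀ t, erl 4 (a+1) t * EL 3 4 b t = (2 / Real.pi) * (kap / kap ^ b) *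
      (∫ y in Set.Ioc (0:ℝ) Real.pi, erl 4 (a+1) t * Real.exp (-(4 * t * G y)) * H b y)
        + 3 * erl 4 (a+1) t := by
    intro t
    rw [EL, rpow_eq, intervalIntegral.integral_of_le hpi]
    simp_rw [gam_eq, mul_assoc (erl 4 (a+1) t)]
    rw [integral_const_mul]
    have : ∀ y, Real.exp (-(4 * t * G y)) / G y ^ 2 * (aco (3/4) b y * Real.sin y)
        = Real.exp (-(4 * t * G y)) * H b y := by
      intro y; have := (G_pos y).ne'; unfold H; field_simp
    simp_rw [this]
    ring
  simp_rw [hEL]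
  have hi : Integrable (fun t => ∫ y in Set.Ioc (0:ℝ) Real.pi,
      erl 4 (a+1) t * Real.exp (-(4 * t * G y)) * H b y) (volume.restrict (Set.Ioi (0:ℝ))) :=
    hp.integral_prod_left
  rw [integral_add (hi.const_mul _) ((erl_int a).integrable.const_mul _), integral_const_mul,
    integral_const_mul, integral_integral_swap hp, J_eq, intervalIntegral.integral_of_le hpi]
  have h1 := erl_lap a 0 le_rfl
  simp at h1
  rw [h1, mul_one]
  congr 3
  funext y
  rw [integral_mul_const, erl_lap a (G y) (G_pos y).le, H, wt]
  ring

/-- For λ = 3, μ = 4: joining the longer queue (12) first beats joining the shorter (10) first. -/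
theorem ETT_longer_first_12_10 : ETT 3 4 12 10 < ETT 3 4 10 12 := by
  unfold ETT
  rw [main_int, main_int]
  have h1 := J_lower 11 12
  have h2 := J_upper 13 le_rfl 10
  have h3 : EE 13 10 < 1/2 := by
    have : T 13 10 < 500 := by decide
    have h : (T 13 10 : ℝ) < 500 := by exact_mod_cast this
    simp [EE]; linarith
  norm_num at *
  linarith
end
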